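/- arXiv:1502.05556 — 4 statements merged into one kernel-verified Lean document; each statement's English description precedes it below -/
import Mathlib

section
/- A vector π in the interior of the probability simplex is a fixed point of the Adjusted Rank Centrality map, i.e., satisfies π P(π) = π where P(π)_ij = ε_π a_ij/(π_i+π_j) for i ≠ j with ε_π = (min_l π_l)/d_max and P(π)_ii = 1 − ε_π Σ_{l≠i} a_il/(π_i+π_l), if and only if it satisfies the maximum-likelihood stationarity conditions: for every i ∈ [n], Σ_{j∈N_i} (π_i a_ij − π_j a_ji)/(π_i + π_j) = 0. -/
/-- One coordinate of `π P`, for any step size `ε`, is `π j` minus `ε` times the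
likelihood gradient sum at `j`. -/
lemma sum_mul_arc_transition_eq {V : Type*} [Fintype V] [DecidableEq V]
    (G : SimpleGraph V) [DecidableRel G.Adj] (a : V → V → ℝ)
    (hnonedge : ∀ i j, ¬ G.Adj i j → a i j = 0) (π : V → ℝ) (ε : ℝ) (j : V) :
    ∑ i, π i *
        (if i = j then 1 - ε * ∑ l ∈ Finset.univ.erase j, a j l / (π j + π l)
         else ε * (a i j / (π i + π j)))
      = π j - ε * ∑ l ∈ G.neighborFinset j, (π j * a j l - π l * a l j) / (π j + π l) := by
  have hsub : G.neighborFinset j ⊆ Finset.univ.erase j := fun l hl => by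
    simpa using ((G.mem_neighborFinset j l).1 hl).ne'
  have hext : ∑ l ∈ G.neighborFinset j, (π j * a j l - π l * a l j) / (π j + π l)
      = ∑ l ∈ Finset.univ.erase j, (π j * a j l - π l * a l j) / (π j + π l) := by
    refine Finset.sum_subset hsub fun l _ hl => ?_
    have hjl : ¬ G.Adj j l := by simpa using hl
    rw [hnonedge j l hjl, hnonedge l j fun h => hjl h.symm]
    simp
  rw [hext, ← Finset.add_sum_erase _ _ (Finset.mem_univ j), if_pos rfl, mul_sub, mul_one,
    sub_add, Finset.mul_sum, Finset.mul_sum, Finset.mul_sum, ← Finset.sum_sub_distrib]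
  congr 1
  refine Finset.sum_congr rfl fun l hl => ?_
  rw [if_neg (Finset.ne_of_mem_erase hl), add_comm (π l)]
  ring

/-- **Fixed points of the Adjusted Rank Centrality map = ML stationarity conditions.**
A vector `π` in the interior of the probability simplex satisfies `π P(π) = π`, where
`P(π) i j = ε_π * a i j / (π i + π j)` off the diagonal with `ε_π = (min_l π l)/d_max`,
if and only if for every `i`, `Σ_{j ∈ N i} (π i * a i j − π j * a j i)/(π i + π j) = 0`. -/
theorem arc_fixed_point_iff_ml_stationarity (n : ℕ) (hn : 0 < n)
    (G : SimpleGraph (Fin n)) [DecidableRel G.Adj] (a : Fin n → Fin n → ℝ)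
    (ha01 : ∀ i j, G.Adj i j → a i j ∈ Set.Icc (0 : ℝ) 1)
    (hsum1 : ∀ i j, G.Adj i j → a i j + a j i = 1)
    (hnonedge : ∀ i j, ¬ G.Adj i j → a i j = 0)
    (π : Fin n → ℝ) (hpos : ∀ i, 0 < π i) (hsum : ∑ i, π i = 1) :
    (∀ j, ∑ i, π i *
        (if i = j then
          1 - (Finset.univ.inf' (Finset.univ_nonempty_iff.mpr (Fin.pos_iff_nonempty.mp hn)) π
                / (G.maxDegree : ℝ)) * ∑ l ∈ Finset.univ.erase j, a j l / (π j + π l)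
         else (Finset.univ.inf' (Finset.univ_nonempty_iff.mpr (Fin.pos_iff_nonempty.mp hn)) π
                / (G.maxDegree : ℝ)) * (a i j / (π i + π j))) = π j)
      ↔ (∀ i, ∑ j ∈ G.neighborFinset i,
            (π i * a i j - π j * a j i) / (π i + π j) = 0) := by
  simp_rw [sum_mul_arc_transition_eq G a hnonedge π, sub_eq_self, mul_eq_zero]
  refine ⟨fun h i => ?_, fun h j => Or.inr (h j)⟩
  refine (h i).elim (fun hε => ?_) id
  have hmin : Finset.univ.inf' (Finset.univ_nonempty_iff.mpr (Fin.pos_iff_nonempty.mp hn)) π ≠ 0 :=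
    ((Finset.lt_inf'_iff _).2 fun i _ => hpos i).ne'
  have hmax : G.maxDegree = 0 := by
    exact_mod_cast (div_eq_zero_iff.1 hε).resolve_left hmin
  have hdeg : G.degree i = 0 := Nat.le_zero.1 (hmax ▸ G.degree_le_maxDegree i)
  rw [Finset.card_eq_zero.1 ((G.card_neighborFinset_eq_degree i).trans hdeg), Finset.sum_empty]
end

section
/- Contraction lemma for simplex maps with positive stochastic Jacobian. Let Δ° = {x ∈ ℝⁿ : x_i > 0 ∀i, Σ_i x_i = 1} and let S be continuously differentiable on an open set containing Δ°, mapping Δ° into Δ°. Suppose there is ε > 0 such that for every x ∈ Δ°, every entry of the Jacobian matrix S'(x) = (∂S_i/∂x_j(x)) is at least ε and every column of S'(x) sums to 1. Then for all x, y ∈ Δ°: ‖S(y) − S(x)‖₁ ≤ (1 − nε) ‖y − x‖₁; in particular S is a contraction on Δ° for the ℓ¹ norm. -/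
/-- The open probability simplex is convex. -/
theorem convex_openSimplex (n : ℕ) :
    Convex ℝ {x : Fin n → ℝ | (∀ i, 0 < x i) ∧ ∑ i, x i = 1} := by
  rintro x ⟨hx, hx1⟩ y ⟨hy, hy1⟩ a b ha hb hab
  refine ⟨fun i => convex_Ioi (0 : ℝ) (hx i) (hy i) ha hb hab, ?_⟩
  simp [Finset.sum_add_distrib, ← Finset.mul_sum, hx1, hy1, hab]

/-- A linear map whose matrix has entries at least `ε` and columns summing to `1` contracts the
`ℓ¹` norm of vectors with zero sum by the factor `1 - n ε`. -/
theorem sum_abs_apply_le_of_stochastic {n : ℕ} {ε : ℝ} (L : (Fin n → ℝ) →L[ℝ] (Fin n → ℝ))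
    (hpos : ∀ i j, ε ≤ L (Pi.single j 1) i) (hcol : ∀ j, ∑ i, L (Pi.single j 1) i = 1)
    {v : Fin n → ℝ} (hv : ∑ i, v i = 0) :
    ∑ i, |L v i| ≤ (1 - (n : ℝ) * ε) * ∑ i, |v i| := by
  have hL (i : Fin n) : L v i = ∑ j, (L (Pi.single j 1) i - ε) * v j := by
    conv_lhs => rw [pi_eq_sum_univ' v]
    simp [sub_mul, Finset.sum_sub_distrib, ← Finset.mul_sum, hv, mul_comm (v _)]
  calc ∑ i, |L v i| ≤ ∑ i, ∑ j, (L (Pi.single j 1) i - ε) * |v j| := by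
        refine Finset.sum_le_sum fun i _ => ?_
        rw [hL]
        refine (Finset.abs_sum_le_sum_abs _ _).trans_eq (Finset.sum_congr rfl fun j _ => ?_)
        rw [abs_mul, abs_of_nonneg (sub_nonneg.2 (hpos i j))]
    _ = (1 - (n : ℝ) * ε) * ∑ i, |v i| := by
        rw [Finset.sum_comm, Finset.mul_sum]
        refine Finset.sum_congr rfl fun j _ => ?_
        rw [← Finset.sum_mul, Finset.sum_sub_distrib, hcol]
        simp

/-- **Contraction lemma for simplex maps with positive stochastic Jacobian.**
Let `Δ°` be the interior of the probability simplex in `ℝⁿ` and `S` a `C¹` map on an open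
set containing `Δ°` mapping `Δ°` into itself. If every entry of the Jacobian of `S` on `Δ°`
is at least `ε > 0` and every column of the Jacobian sums to `1`, then
`‖S y − S x‖₁ ≤ (1 − n ε) ‖y − x‖₁` for all `x, y ∈ Δ°`. -/
theorem simplex_contraction_of_positive_stochastic_jacobian (n : ℕ) (ε : ℝ) (hε : 0 < ε)
    (S : (Fin n → ℝ) → (Fin n → ℝ)) (U : Set (Fin n → ℝ)) (hU : IsOpen U)
    (hΔU : {x : Fin n → ℝ | (∀ i, 0 < x i) ∧ ∑ i, x i = 1} ⊆ U)
    (hmaps : Set.MapsTo S {x : Fin n → ℝ | (∀ i, 0 < x i) ∧ ∑ i, x i = 1}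
      {x : Fin n → ℝ | (∀ i, 0 < x i) ∧ ∑ i, x i = 1})
    (hS : ContDiffOn ℝ 1 S U)
    (hJpos : ∀ x ∈ {x : Fin n → ℝ | (∀ i, 0 < x i) ∧ ∑ i, x i = 1},
      ∀ i j, ε ≤ fderiv ℝ S x (Pi.single j 1) i)
    (hJcol : ∀ x ∈ {x : Fin n → ℝ | (∀ i, 0 < x i) ∧ ∑ i, x i = 1},
      ∀ j, ∑ i, fderiv ℝ S x (Pi.single j 1) i = 1) :
    ∀ x ∈ {x : Fin n → ℝ | (∀ i, 0 < x i) ∧ ∑ i, x i = 1},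
    ∀ y ∈ {x : Fin n → ℝ | (∀ i, 0 < x i) ∧ ∑ i, x i = 1},
      ∑ i, |S y i - S x i| ≤ (1 - (n : ℝ) * ε) * ∑ i, |y i - x i| := by
  intro x hx y hy
  let w (i : Fin n) : ℝ := SignType.sign (S y i - S x i)
  have hw (i : Fin n) : |w i| ≤ 1 := by
    rcases lt_trichotomy (S y i - S x i) 0 with h | h | h <;> simp [w, h]
  let ℓ : (Fin n → ℝ) →L[ℝ] ℝ := ∑ i, w i • ContinuousLinearMap.proj i
  have hℓ (u : Fin n → ℝ) : ℓ u = ∑ i, w i * u i := by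
    simp [ℓ]
  have hderiv : ∀ z ∈ {x : Fin n → ℝ | (∀ i, 0 < x i) ∧ ∑ i, x i = 1},
      HasFDerivWithinAt (fun z => ℓ (S z)) (ℓ.comp (fderiv ℝ S z))
        {x : Fin n → ℝ | (∀ i, 0 < x i) ∧ ∑ i, x i = 1} z := fun z hz =>
    (ℓ.hasFDerivAt.comp z ((hS.differentiableOn one_ne_zero).differentiableAt
      (hU.mem_nhds (hΔU hz))).hasFDerivAt).hasFDerivWithinAt
  obtain ⟨z, hz, hmvt⟩ := domain_mvt hderiv (convex_openSimplex n) hx hy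
  have hzΔ := (convex_openSimplex n).segment_subset hx hy hz
  calc ∑ i, |S y i - S x i| = ℓ (S y) - ℓ (S x) := by
        rw [← map_sub, hℓ]
        exact Finset.sum_congr rfl fun i _ => (sign_mul_self _).symm
    _ = ∑ i, w i * fderiv ℝ S z (y - x) i := by rw [hmvt, ContinuousLinearMap.comp_apply, hℓ]
    _ ≤ ∑ i, |fderiv ℝ S z (y - x) i| := by
        refine Finset.sum_le_sum fun i _ => (le_abs_self _).trans ?_
        rw [abs_mul]
        exact mul_le_of_le_one_left (abs_nonneg _) (hw i)
    _ ≤ (1 - (n : ℝ) * ε) * ∑ i, |y i - x i| :=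
        sum_abs_apply_le_of_stochastic _ (hJpos z hzΔ) (hJcol z hzΔ) (by
          simp [Finset.sum_sub_distrib, hx.2, hy.2])
end

section
/- Theorem 3 (convergence of Adjusted Rank Centrality). Let G([n],E) be a graph with neighborhoods N_i and maximum degree d_max, and let a_ij ∈ (0,1) with a_ij + a_ji = 1 for edges and a_ij = 0 otherwise. Define P(π)_ij = ε_π a_ij/(π_i+π_j) for i ≠ j, with ε_π = (min_l π_l)/d_max, and P(π)_ii = 1 − ε_π Σ_{l≠i} a_il/(π_i+π_l), and let P̄ be the Rank Centrality chain (P̄_ij = a_ij/d_max for i ≠ j). If P̄ is irreducible and aperiodic (equivalently, some power of P̄ has all entries strictly positive), then there is a unique π̂ in the interior of the probability simplex satisfying Σ_{j∈N_i}(π̂_i a_ij − π̂_j a_ji)/(π̂_i+π̂_j) = 0 for all i (the maximum-likelihood estimate), and the iteration π^{(0)} = (1/n,…,1/n), π^{(t+1)} = π^{(t)} P(π^{(t)}) converges to π̂. -/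
noncomputable section

/-- The Rank Centrality Markov chain `P̄` on `[n]`: `P̄ i j = a i j / d_max` for `i ≠ j`. -/
def rcMatrix {n : ℕ} (dmax : ℕ) (a : Fin n → Fin n → ℝ) : Matrix (Fin n) (Fin n) ℝ :=
  fun i j =>
    if i = j then 1 - (1 / (dmax : ℝ)) * ∑ l ∈ Finset.univ.erase i, a i l
    else (1 / (dmax : ℝ)) * a i j

/-- The Adjusted Rank Centrality Markov chain `P(π)`:
`P(π) i j = ε_π * a i j / (π i + π j)` for `i ≠ j`, with `ε_π = (min_l π l) / d_max`. -/
def arcMatrix {n : ℕ} [NeZero n] (dmax : ℕ) (a : Fin n → Fin n → ℝ)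
    (π : Fin n → ℝ) : Matrix (Fin n) (Fin n) ℝ :=
  fun i j =>
    if i = j then
      1 - (Finset.univ.inf' Finset.univ_nonempty π / (dmax : ℝ)) *
            ∑ l ∈ Finset.univ.erase i, a i l / (π i + π l)
    else (Finset.univ.inf' Finset.univ_nonempty π / (dmax : ℝ)) * (a i j / (π i + π j))

section BradleyTerry

variable {ι : Type*} [Fintype ι]

/-- The Bradley–Terry log-likelihood. -/
def btLogLik (a : ι → ι → ℝ) (π : ι → ℝ) : ℝ :=
  ∑ i, ∑ j, a j i * (Real.log (π i) - Real.log (π i + π j))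

/-- The gradient of the Bradley–Terry log-likelihood with respect to `log π`. -/
def btScore (a : ι → ι → ℝ) (π : ι → ℝ) (i : ι) : ℝ :=
  ∑ j, (a j i * π j - a i j * π i) / (π i + π j)

/-- The total weight of the comparisons of `i`, each scaled by `1 / (π i + π j)`. -/
def btWeight (a : ι → ι → ℝ) (π : ι → ℝ) (i : ι) : ℝ :=
  ∑ j, (a i j + a j i) / (π i + π j)

theorem sum_btScore (a : ι → ι → ℝ) (π : ι → ℝ) : ∑ i, btScore a π i = 0 := by
  have h : ∑ i, btScore a π i = -∑ i, btScore a π i := by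
    unfold btScore
    conv_lhs => rw [Finset.sum_comm]
    rw [← Finset.sum_neg_distrib]
    refine Finset.sum_congr rfl fun i _ => ?_
    rw [← Finset.sum_neg_distrib]
    refine Finset.sum_congr rfl fun j _ => ?_
    rw [← neg_div, add_comm (π j)]
    congr 1
    ring
  linarith

theorem btScore_eq (a : ι → ι → ℝ) {π : ι → ℝ} (hπ : ∀ i, 0 < π i) (i : ι) :
    btScore a π i = ∑ j, a j i - π i * btWeight a π i := by
  rw [btScore, btWeight, Finset.mul_sum, ← Finset.sum_sub_distrib]
  refine Finset.sum_congr rfl fun j _ => ?_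
  have := (add_pos (hπ i) (hπ j)).ne'
  field_simp
  ring

theorem btLogLik_nonpos {a : ι → ι → ℝ} (ha : ∀ i j, 0 ≤ a i j) {π : ι → ℝ}
    (hπ : ∀ i, 0 < π i) : btLogLik a π ≤ 0 :=
  Finset.sum_nonpos fun i _ => Finset.sum_nonpos fun j _ =>
    mul_nonpos_of_nonneg_of_nonpos (ha j i)
      (sub_nonpos.2 (Real.log_le_log (hπ i) (by linarith [hπ j])))

theorem btLogLik_le_term {a : ι → ι → ℝ} (ha : ∀ i j, 0 ≤ a i j) {π : ι → ℝ}
    (hπ : ∀ i, 0 < π i) (i j : ι) :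
    btLogLik a π ≤ a j i * (Real.log (π i) - Real.log (π i + π j)) := by
  have h (k l : ι) : 0 ≤ -(a l k * (Real.log (π k) - Real.log (π k + π l))) :=
    neg_nonneg.2 (mul_nonpos_of_nonneg_of_nonpos (ha l k)
      (sub_nonpos.2 (Real.log_le_log (hπ k) (by linarith [hπ l]))))
  have h1 := (Finset.single_le_sum (fun l _ => h i l) (Finset.mem_univ j)).trans
    (Finset.single_le_sum (f := fun k => ∑ l, -(a l k * (Real.log (π k) - Real.log (π k + π l))))
      (fun k _ => Finset.sum_nonneg fun l _ => h k l) (Finset.mem_univ i))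
  simp only [Finset.sum_neg_distrib] at h1
  exact neg_le_neg_iff.1 h1

theorem log_sub_log_le {x y : ℝ} (hx : 0 < x) (hy : 0 < y) :
    Real.log y - Real.log x ≤ (y - x) / x := by
  rw [← Real.log_div hy.ne' hx.ne', sub_div, div_self hx.ne']
  exact Real.log_le_sub_one_of_pos (div_pos hy hx)

/-- Quantitative ascent of the log-likelihood under a short step along the score. -/
theorem btLogLik_add_le {a : ι → ι → ℝ} (ha : ∀ i j, 0 ≤ a i j) {π : ι → ℝ}
    (hπ : ∀ i, 0 < π i) {e : ℝ} (hpos : ∀ i, 0 < π i + e * btScore a π i) :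
    btLogLik a π + ∑ i, e * (1 - e * btWeight a π i) * btScore a π i ^ 2 /
        (π i + e * btScore a π i) ≤
      btLogLik a (fun i => π i + e * btScore a π i) := by
  set F := btScore a π with hF
  have hdiff : btLogLik a (fun i => π i + e * F i) - btLogLik a π =
      ∑ i, ((∑ j, a j i) * (Real.log (π i + e * F i) - Real.log (π i)) -
        ∑ j, a j i * (Real.log (π i + e * F i + (π j + e * F j)) - Real.log (π i + π j))) := by
    simp only [btLogLik, Finset.sum_mul, ← Finset.sum_sub_distrib]
    refine Finset.sum_congr rfl fun i _ => Finset.sum_congr rfl fun j _ => ?_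
    ring
  have htan : ∑ i, ∑ j, a j i *
      (Real.log (π i + e * F i + (π j + e * F j)) - Real.log (π i + π j)) ≤
      ∑ i, e * F i * btWeight a π i := by
    calc _ ≤ ∑ i, ∑ j, (a j i * (e * F i) / (π i + π j) + a j i * (e * F j) / (π i + π j)) := by
          refine Finset.sum_le_sum fun i _ => Finset.sum_le_sum fun j _ => ?_
          refine (mul_le_mul_of_nonneg_left (log_sub_log_le (add_pos (hπ i) (hπ j))
            (add_pos (hpos i) (hpos j))) (ha j i)).trans (le_of_eq ?_)
          ring
      _ = _ := by
          simp only [Finset.sum_add_distrib]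
          rw [Finset.sum_comm (f := fun i j => a j i * (e * F j) / (π i + π j)),
            ← Finset.sum_add_distrib]
          refine Finset.sum_congr rfl fun i _ => ?_
          rw [btWeight, Finset.mul_sum, ← Finset.sum_add_distrib]
          refine Finset.sum_congr rfl fun j _ => ?_
          rw [add_comm (π j)]
          ring
  have hmain : ∑ i, (e * (1 - e * btWeight a π i) * F i ^ 2 / (π i + e * F i) +
      e * F i * btWeight a π i) ≤
      ∑ i, (∑ j, a j i) * (Real.log (π i + e * F i) - Real.log (π i)) := by
    refine Finset.sum_le_sum fun i _ => ?_
    have hlog := log_sub_log_le (hpos i) (hπ i)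
    have hW : 0 ≤ ∑ j, a j i := Finset.sum_nonneg fun j _ => ha j i
    have hlog' : e * F i / (π i + e * F i) ≤ Real.log (π i + e * F i) - Real.log (π i) := by
      have : e * F i / (π i + e * F i) = -((π i - (π i + e * F i)) / (π i + e * F i)) := by ring
      linarith
    refine le_trans (le_of_eq ?_) (mul_le_mul_of_nonneg_left hlog' hW)
    have hFi : ∑ j, a j i = F i + π i * btWeight a π i := by
      rw [hF, btScore_eq a hπ]; ring
    have := (hpos i).ne'
    rw [hFi]
    field_simp
    ring
  rw [Finset.sum_sub_distrib] at hdiff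
  rw [Finset.sum_add_distrib] at hmain
  linarith

theorem continuousAt_btScore (a : ι → ι → ℝ) {π : ι → ℝ} (hπ : ∀ i, 0 < π i) (i : ι) :
    ContinuousAt (fun σ => btScore a σ i) π := by
  unfold btScore
  refine tendsto_finsetSum _ fun j _ => ContinuousAt.div (by fun_prop) (by fun_prop) ?_
  exact (add_pos (hπ i) (hπ j)).ne'

theorem continuousAt_btLogLik (a : ι → ι → ℝ) {π : ι → ℝ} (hπ : ∀ i, 0 < π i) :
    ContinuousAt (btLogLik a) π := by
  unfold btLogLik
  refine tendsto_finsetSum _ fun i _ => tendsto_finsetSum _ fun j _ => ?_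
  have h1 := (hπ i).ne'
  have h2 := (add_pos (hπ i) (hπ j)).ne'
  exact ContinuousAt.mul continuousAt_const
    (ContinuousAt.sub ((continuous_apply i).continuousAt.log h1)
      (((continuous_apply i).add (continuous_apply j)).continuousAt.log h2))

variable {G : SimpleGraph ι} {a : ι → ι → ℝ}

/-- On a connected comparison graph, the zero of the score is unique up to scaling. -/
theorem eq_of_btScore_eq_zero (hG : G.Preconnected) (ha : ∀ i j, 0 ≤ a i j)
    (hadj : ∀ i j, G.Adj i j → 0 < a i j) {π σ : ι → ℝ} (hπ : ∀ i, 0 < π i) (hσ : ∀ i, 0 < σ i)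
    (hsum : ∑ i, π i = ∑ i, σ i)
    (hπ0 : ∀ i, btScore a π i = 0) (hσ0 : ∀ i, btScore a σ i = 0) : π = σ := by
  rcases isEmpty_or_nonempty ι with _ | _
  · exact Subsingleton.elim _ _
  obtain ⟨i₀, hi₀⟩ := Finite.exists_max fun i => π i / σ i
  have hratio (j : ι) : ∀ k, π k / σ k ≤ π j / σ j := by
    induction (SimpleGraph.reachable_iff_reflTransGen _ _).1 (hG i₀ j) with
    | refl => exact hi₀
    | @tail i j _ hij ih =>
      have hle (k : ι) : (a k i * π k - a i k * π i) / (π i + π k) ≤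
          (a k i * σ k - a i k * σ i) / (σ i + σ k) := by
        have hk := (div_le_div_iff₀ (hσ k) (hσ i)).1 (ih k)
        rw [div_le_div_iff₀ (add_pos (hπ i) (hπ k)) (add_pos (hσ i) (hσ k))]
        nlinarith [mul_le_mul_of_nonneg_left hk (add_nonneg (ha i k) (ha k i))]
      have heq := (Finset.sum_eq_sum_iff_of_le fun k _ => hle k).1
        ((hπ0 i).trans (hσ0 i).symm) j (Finset.mem_univ j)
      rw [div_eq_div_iff (add_pos (hπ i) (hπ j)).ne' (add_pos (hσ i) (hσ j)).ne'] at heq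
      have hs : a i j + a j i ≠ 0 := (add_pos (hadj i j hij) (hadj j i hij.symm)).ne'
      have : π i / σ i = π j / σ j := by
        rw [div_eq_div_iff (hσ i).ne' (hσ j).ne']
        apply mul_left_cancel₀ hs
        linarith
      exact this ▸ ih
  have hπσ (j : ι) : π j = π i₀ / σ i₀ * σ j := by
    rw [le_antisymm (hratio j i₀) (hi₀ j), div_mul_cancel₀ _ (hσ j).ne']
  have hpos : 0 < ∑ i, σ i := Finset.sum_pos (fun i _ => hσ i) Finset.univ_nonempty
  have hone : π i₀ / σ i₀ = 1 := by
    rw [Finset.sum_congr rfl fun j _ => hπσ j, ← Finset.mul_sum] at hsum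
    exact (mul_eq_right₀ hpos.ne').1 hsum
  funext j
  rw [hπσ, hone, one_mul]

/-- A lower bound on the log-likelihood bounds the ratios of coordinates. -/
theorem exists_forall_le_mul_of_le_btLogLik (hG : G.Preconnected) (ha : ∀ i j, 0 ≤ a i j)
    (hadj : ∀ i j, G.Adj i j → 0 < a i j) (c : ℝ) (i j : ι) :
    ∃ C, ∀ π : ι → ℝ, (∀ i, 0 < π i) → c ≤ btLogLik a π → π i ≤ C * π j := by
  suffices ∃ C, 0 < C ∧ ∀ π : ι → ℝ, (∀ i, 0 < π i) → c ≤ btLogLik a π → π i ≤ C * π j from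
    this.imp fun _ h => h.2
  induction (SimpleGraph.reachable_iff_reflTransGen _ _).1 (hG i j) with
  | refl => exact ⟨1, one_pos, fun π _ _ => (one_mul _).ge⟩
  | @tail k j _ hkj ih =>
    obtain ⟨C, hC, h⟩ := ih
    refine ⟨C * Real.exp (-c / a k j), by positivity, fun π hπ hc => (h π hπ hc).trans ?_⟩
    rw [mul_assoc]
    refine mul_le_mul_of_nonneg_left ?_ hC.le
    have h1 := hc.trans (btLogLik_le_term ha hπ j k)
    rw [← div_le_iff₀' (hadj k j hkj)] at h1
    have h2 := Real.log_le_log (hπ k) (show π k ≤ π j + π k by linarith [hπ j])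
    rw [← Real.log_le_log_iff (hπ k) (by have := hπ j; positivity),
      Real.log_mul (Real.exp_pos _).ne' (hπ j).ne', Real.log_exp, neg_div]
    linarith

/-- The superlevel sets of the log-likelihood stay away from the boundary of the simplex. -/
theorem exists_pos_le_of_le_btLogLik (hG : G.Preconnected) (ha : ∀ i j, 0 ≤ a i j)
    (hadj : ∀ i j, G.Adj i j → 0 < a i j) (c : ℝ) :
    ∃ δ : ι → ℝ, (∀ i, 0 < δ i) ∧ ∀ π : ι → ℝ, (∀ i, 0 < π i) → ∑ i, π i = 1 →
      c ≤ btLogLik a π → ∀ i, δ i ≤ π i := by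
  choose C hC using exists_forall_le_mul_of_le_btLogLik hG ha hadj c
  refine ⟨fun j => (max 1 (∑ i, C i j))⁻¹, fun j => by positivity, fun π hπ hsum hc j => ?_⟩
  rw [inv_le_iff_one_le_mul₀' (by positivity)]
  calc (1 : ℝ) = ∑ i, π i := hsum.symm
    _ ≤ ∑ i, C i j * π j := Finset.sum_le_sum fun i _ => hC i j π hπ hc
    _ = (∑ i, C i j) * π j := (Finset.sum_mul ..).symm
    _ ≤ _ := mul_le_mul_of_nonneg_right (le_max_right _ _) (hπ j).le

theorem add_mul_btScore_pos (ha : ∀ i j, 0 ≤ a i j) {π : ι → ℝ} (hπ : ∀ i, 0 < π i) {e : ℝ}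
    (he0 : 0 ≤ e) {i : ι} (he : e * btWeight a π i < 1) : 0 < π i + e * btScore a π i := by
  rw [btScore_eq a hπ]
  have h1 : 0 ≤ e * ∑ j, a j i := mul_nonneg he0 (Finset.sum_nonneg fun j _ => ha j i)
  nlinarith [mul_pos (hπ i) (sub_pos.2 he)]

/-- Score ascent with a state-dependent, sufficiently short step converges to the maximum-likelihood
estimate. -/
theorem exists_tendsto_of_btScore_step [Nonempty ι] (hG : G.Preconnected)
    (ha : ∀ i j, 0 ≤ a i j) (hadj : ∀ i j, G.Adj i j → 0 < a i j) {e : (ι → ℝ) → ℝ}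
    (he0 : ∀ π, (∀ i, 0 < π i) → 0 ≤ e π)
    (he1 : ∀ π, (∀ i, 0 < π i) → ∀ i, e π * btWeight a π i < 1)
    (hez : ∀ π, (∀ i, 0 < π i) → ∀ i, e π * btScore a π i = 0 → btScore a π i = 0)
    (hec : Continuous e) :
    ∃ p : ι → ℝ, ((∀ i, 0 < p i) ∧ ∑ i, p i = 1 ∧ ∀ i, btScore a p i = 0) ∧
      ∀ seq : ℕ → ι → ℝ, (∀ i, 0 < seq 0 i) → ∑ i, seq 0 i = 1 →
        (∀ t, seq (t + 1) = fun i => seq t i + e (seq t) * btScore a (seq t) i) →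
        Filter.Tendsto seq Filter.atTop (nhds p) := by
  set φ : (ι → ℝ) → ι → ℝ := fun π i => π i + e π * btScore a π i with hφ
  have hφpos (π) (hπ : ∀ i, 0 < π i) (i) : 0 < φ π i :=
    add_mul_btScore_pos ha (π := π) hπ (he0 π hπ) (he1 π hπ i)
  have hgain (π) (hπ : ∀ i, 0 < π i) (i) :
      0 ≤ e π * (1 - e π * btWeight a π i) * btScore a π i ^ 2 / φ π i :=
    div_nonneg (mul_nonneg (mul_nonneg (he0 π hπ) (sub_nonneg.2 (he1 π hπ i).le)) (sq_nonneg _))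
      (hφpos π hπ i).le
  have hascent (π) (hπ : ∀ i, 0 < π i) : btLogLik a π ≤ btLogLik a (φ π) := by
    have h1 := btLogLik_add_le ha hπ (hφpos π hπ)
    have h2 := Finset.sum_nonneg fun i (_ : i ∈ Finset.univ) => hgain π hπ i
    linarith
  have hstat (π) (hπ : ∀ i, 0 < π i) (h : btLogLik a (φ π) = btLogLik a π) (i) :
      btScore a π i = 0 := by
    have h1 := btLogLik_add_le ha hπ (hφpos π hπ)
    have h2 := Finset.single_le_sum (fun i _ => hgain π hπ i) (Finset.mem_univ i)
    have h3 : e π * (1 - e π * btWeight a π i) * btScore a π i ^ 2 / φ π i = 0 :=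
      le_antisymm (by linarith) (hgain π hπ i)
    have hne := (sub_pos.2 (he1 π hπ i)).ne'
    have hne' := (hφpos π hπ i).ne'
    apply hez π hπ i
    simpa [hne, hne'] using h3
  have hφc (π) (hπ : ∀ i, 0 < π i) : ContinuousAt φ π :=
    continuousAt_pi.2 fun i => (continuous_apply i).continuousAt.add
      (hec.continuousAt.mul (continuousAt_btScore a (π := π) hπ i))
  -- Every orbit stays in a compact set on which all cluster points are stationary.
  have horbit (seq : ℕ → ι → ℝ) (h0 : ∀ i, 0 < seq 0 i) (h0s : ∑ i, seq 0 i = 1)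
      (hseq : ∀ t, seq (t + 1) = φ (seq t)) :
      ∃ K : Set (ι → ℝ), IsCompact K ∧ (∀ t, seq t ∈ K) ∧ ∀ p ∈ K,
        ((∀ i, 0 < p i) ∧ ∑ i, p i = 1) ∧
          (MapClusterPt p Filter.atTop seq → ∀ i, btScore a p i = 0) := by
    have hpos (t) : ∀ i, 0 < seq t i := by
      induction t with
      | zero => exact h0
      | succ t ih => rw [hseq]; exact hφpos _ ih
    have hsum (t) : ∑ i, seq t i = 1 := by
      induction t with
      | zero => exact h0s
      | succ t ih =>
        rw [hseq, hφ, Finset.sum_add_distrib, ← Finset.mul_sum, sum_btScore, ih]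
        simp
    have hmono : Monotone fun t => btLogLik a (seq t) :=
      monotone_nat_of_le_succ fun t => by rw [hseq]; exact hascent _ (hpos t)
    have hlim := tendsto_atTop_ciSup hmono ⟨0, by
      rintro _ ⟨t, rfl⟩
      exact btLogLik_nonpos ha (hpos t)⟩
    obtain ⟨δ, hδ, hle⟩ := exists_pos_le_of_le_btLogLik hG ha hadj (btLogLik a (seq 0))
    refine ⟨Set.Icc δ (fun _ => 1) ∩ {p | ∑ i, p i = 1},
      isCompact_Icc.inter_right (isClosed_eq (by fun_prop) continuous_const),
      fun t => ⟨⟨hle _ (hpos t) (hsum t) (hmono t.zero_le), fun i => ?_⟩, hsum t⟩,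
      fun p hp => ?_⟩
    · rw [← hsum t]
      exact Finset.single_le_sum (fun i _ => (hpos t i).le) (Finset.mem_univ i)
    · have hp0 (i) : 0 < p i := (hδ i).trans_le (hp.1.1 i)
      refine ⟨⟨hp0, hp.2⟩, fun hcl => hstat p hp0 ?_⟩
      obtain ⟨U, hU, hUp⟩ := mapClusterPt_iff_ultrafilter.1 hcl
      have h1 := tendsto_nhds_unique ((continuousAt_btLogLik a hp0).tendsto.comp hUp)
        (hlim.mono_left hU)
      have h2 := ((continuousAt_btLogLik a (hφpos p hp0)).tendsto.comp
        ((hφc p hp0).tendsto.comp hUp))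
      have h3 := ((Filter.tendsto_add_atTop_iff_nat 1).2 hlim).mono_left hU
      simp only [hseq] at h3
      exact (tendsto_nhds_unique h2 h3).trans h1.symm
  have hcard : (0 : ℝ) < Fintype.card ι := by exact_mod_cast Fintype.card_pos
  obtain ⟨K, hK, hmem, hKp⟩ := horbit (fun t => φ^[t] fun _ => 1 / (Fintype.card ι : ℝ))
    (fun i => by simpa using hcard) (by simp [hcard.ne'])
    (fun t => Function.iterate_succ_apply' ..)
  obtain ⟨p, hpK, hp⟩ := hK.exists_mapClusterPt (f := Filter.atTop)
    (Filter.tendsto_principal.2 (Filter.Eventually.of_forall hmem))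
  refine ⟨p, ⟨(hKp p hpK).1.1, (hKp p hpK).1.2, (hKp p hpK).2 hp⟩, fun seq h0 h0s hseq => ?_⟩
  obtain ⟨K', hK', hmem', hKp'⟩ := horbit seq h0 h0s hseq
  refine hK'.tendsto_nhds_of_unique_mapClusterPt (Filter.Eventually.of_forall hmem')
    fun q hq hcl => ?_
  obtain ⟨⟨hq0, hqs⟩, hqF⟩ := hKp' q hq
  exact eq_of_btScore_eq_zero hG ha hadj hq0 (hKp p hpK).1.1
    (hqs.trans (hKp p hpK).1.2.symm) (hqF hcl) ((hKp p hpK).2 hp)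

end BradleyTerry

theorem reachable_of_rcMatrix_pow_ne_zero {n : ℕ} {G : SimpleGraph (Fin n)} {dmax : ℕ}
    {a : Fin n → Fin n → ℝ} (hnonedge : ∀ i j, ¬ G.Adj i j → a i j = 0) {m : ℕ} {i j : Fin n}
    (h : (rcMatrix dmax a ^ m) i j ≠ 0) : G.Reachable i j := by
  induction m generalizing j with
  | zero =>
    rw [pow_zero, Matrix.one_apply] at h
    rw [show i = j by by_contra hij; simp [hij] at h]
  | succ m ih =>
    rw [pow_succ, Matrix.mul_apply] at h
    obtain ⟨k, -, hk⟩ := Finset.exists_ne_zero_of_sum_ne_zero h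
    refine (ih (left_ne_zero_of_mul hk)).trans ?_
    rcases eq_or_ne k j with rfl | hkj
    · rfl
    · have hkj' := right_ne_zero_of_mul hk
      rw [rcMatrix, if_neg hkj] at hkj'
      by_contra hadj
      exact hkj' (by rw [hnonedge k j fun h => hadj h.reachable, mul_zero])

/-- A step of Adjusted Rank Centrality is a step along the score. -/
theorem sum_mul_arcMatrix {n : ℕ} [NeZero n] (dmax : ℕ) {a : Fin n → Fin n → ℝ}
    (hdiag : ∀ i, a i i = 0) (π : Fin n → ℝ) (j : Fin n) :
    ∑ i, π i * arcMatrix dmax a π i j =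
      π j + Finset.univ.inf' Finset.univ_nonempty π / (dmax : ℝ) * btScore a π j := by
  set e := Finset.univ.inf' Finset.univ_nonempty π / (dmax : ℝ) with he
  have hj := Finset.mem_univ j
  have hoff : ∑ i ∈ Finset.univ.erase j, π i * arcMatrix dmax a π i j =
      e * ∑ i ∈ Finset.univ.erase j, π i * a i j / (π j + π i) := by
    rw [Finset.mul_sum]
    refine Finset.sum_congr rfl fun i hi => ?_
    rw [arcMatrix, if_neg (Finset.ne_of_mem_erase hi), ← he, add_comm (π j)]
    ring
  have hscore : btScore a π j = ∑ i ∈ Finset.univ.erase j, π i * a i j / (π j + π i) -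
      π j * ∑ i ∈ Finset.univ.erase j, a j i / (π j + π i) := by
    rw [btScore, ← Finset.add_sum_erase _ _ hj, hdiag, Finset.mul_sum, ← Finset.sum_sub_distrib]
    simp only [zero_mul, sub_zero, zero_div, zero_add]
    refine Finset.sum_congr rfl fun i _ => ?_
    ring
  rw [← Finset.add_sum_erase _ _ hj, hoff, hscore, arcMatrix, if_pos rfl, ← he]
  ring

/-- **Convergence of Adjusted Rank Centrality.** If the Rank Centrality chain `P̄` is
irreducible and aperiodic (some power of `P̄` is entrywise positive), then there is a unique
point `π̂` of the interior of the probability simplex satisfying the maximum-likelihood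
stationarity conditions, and the ARC iteration `π⁽⁰⁾ = (1/n,…,1/n)`,
`π⁽ᵗ⁺¹⁾ = π⁽ᵗ⁾ P(π⁽ᵗ⁾)` converges to `π̂`. -/
theorem arc_convergence (n : ℕ) [NeZero n] (G : SimpleGraph (Fin n)) [DecidableRel G.Adj]
    (a : Fin n → Fin n → ℝ)
    (ha01 : ∀ i j, G.Adj i j → a i j ∈ Set.Ioo (0 : ℝ) 1)
    (hsum1 : ∀ i j, G.Adj i j → a i j + a j i = 1)
    (hnonedge : ∀ i j, ¬ G.Adj i j → a i j = 0)
    (hprim : ∃ m : ℕ, ∀ i j, 0 < (rcMatrix G.maxDegree a ^ m) i j) :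
    ∃ piHat : Fin n → ℝ,
      ((∀ i, 0 < piHat i) ∧ ∑ i, piHat i = 1 ∧
        ∀ i, ∑ j ∈ G.neighborFinset i,
          (piHat i * a i j - piHat j * a j i) / (piHat i + piHat j) = 0) ∧
      (∀ π : Fin n → ℝ, (∀ i, 0 < π i) → ∑ i, π i = 1 →
        (∀ i, ∑ j ∈ G.neighborFinset i,
          (π i * a i j - π j * a j i) / (π i + π j) = 0) →
        π = piHat) ∧
      (∀ seq : ℕ → Fin n → ℝ, seq 0 = (fun _ => 1 / (n : ℝ)) →
        (∀ t, seq (t + 1) =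
          fun j => ∑ i, seq t i * arcMatrix G.maxDegree a (seq t) i j) →
        Filter.Tendsto seq Filter.atTop (nhds piHat)) := by
  have hnn (i j) : 0 ≤ a i j := by
    by_cases h : G.Adj i j
    · exact (ha01 i j h).1.le
    · exact (hnonedge i j h).ge
  have hpos (i j) (h : G.Adj i j) : 0 < a i j := (ha01 i j h).1
  have hG : G.Preconnected := by
    obtain ⟨m, hm⟩ := hprim
    exact fun i j => reachable_of_rcMatrix_pow_ne_zero hnonedge (hm i j).ne'
  have hscore (π : Fin n → ℝ) (i) : ∑ j ∈ G.neighborFinset i,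
      (π i * a i j - π j * a j i) / (π i + π j) = -btScore a π i := by
    rw [btScore, ← Finset.sum_neg_distrib, ← Finset.sum_subset (Finset.subset_univ _)]
    · refine Finset.sum_congr rfl fun j _ => ?_
      ring
    · intro j _ hj
      rw [SimpleGraph.mem_neighborFinset] at hj
      simp [hnonedge i j hj, hnonedge j i fun h => hj h.symm]
  have hdeg (i) : ∑ j, (a i j + a j i) ≤ G.maxDegree := by
    refine le_trans (le_of_eq ?_) (Nat.cast_le.2 (G.degree_le_maxDegree i))
    rw [← SimpleGraph.card_neighborFinset_eq_degree, Finset.cast_card,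
      ← Finset.sum_subset (Finset.subset_univ (G.neighborFinset i))]
    · exact Finset.sum_congr rfl fun j hj => hsum1 i j ((G.mem_neighborFinset i j).1 hj)
    · intro j _ hj
      rw [SimpleGraph.mem_neighborFinset] at hj
      simp [hnonedge i j hj, hnonedge j i fun h => hj h.symm]
  have hinf (π : Fin n → ℝ) (hπ : ∀ i, 0 < π i) :
      0 < Finset.univ.inf' Finset.univ_nonempty π :=
    (Finset.lt_inf'_iff _).2 fun i _ => hπ i
  obtain ⟨p, ⟨hp, hps, hpF⟩, hconv⟩ := exists_tendsto_of_btScore_step hG hnn hpos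
    (e := fun π => Finset.univ.inf' Finset.univ_nonempty π / (G.maxDegree : ℝ))
    (fun π hπ => div_nonneg (hinf π hπ).le (Nat.cast_nonneg _))
    (fun π hπ i => by
      have hm := hinf π hπ
      set m := Finset.univ.inf' Finset.univ_nonempty π
      have hle (k) : m ≤ π k := Finset.inf'_le _ (Finset.mem_univ k)
      have hD : btWeight a π i ≤ G.maxDegree / (2 * m) := by
        refine le_trans (Finset.sum_le_sum fun j _ => ?_)
          ((Finset.sum_div Finset.univ (fun j => a i j + a j i) (2 * m)).ge.trans
            (div_le_div_of_nonneg_right (hdeg i) (by positivity)))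
        exact div_le_div_of_nonneg_left (add_nonneg (hnn i j) (hnn j i)) (by positivity)
          (by linarith [hle i, hle j])
      refine (mul_le_mul_of_nonneg_left hD (by positivity)).trans_lt ?_
      rcases eq_or_ne (G.maxDegree : ℝ) 0 with h | h
      · simp [h]
      · field_simp
        norm_num)
    (fun π hπ i h => by
      rcases mul_eq_zero.1 h with h | h
      · have hd : (G.maxDegree : ℝ) = 0 := (div_eq_zero_iff.1 h).resolve_left (hinf π hπ).ne'
        have hz : G.neighborFinset i = ∅ := by
          rw [← Finset.card_eq_zero, SimpleGraph.card_neighborFinset_eq_degree]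
          exact Nat.le_zero.1 ((G.degree_le_maxDegree i).trans (Nat.cast_eq_zero.1 hd).le)
        have := hscore π i
        rw [hz, Finset.sum_empty] at this
        linarith
      · exact h)
    ((Continuous.finset_inf'_apply _ fun i _ => continuous_apply i).div_const _)
  refine ⟨p, ⟨hp, hps, fun i => by rw [hscore, hpF, neg_zero]⟩, fun π hπ hs hF => ?_,
    fun seq h0 hseq => hconv seq (fun i => ?_) ?_ fun t => ?_⟩
  · exact eq_of_btScore_eq_zero hG hnn hpos hπ hp (hs.trans hps.symm)
      (fun i => neg_eq_zero.1 ((hscore π i).symm.trans (hF i))) hpF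
  · rw [h0]
    have := NeZero.pos n
    positivity
  · simp [h0, NeZero.ne n]
  · rw [hseq]
    exact funext fun j => sum_mul_arcMatrix _ (fun i => hnonedge i i G.irrefl) _ j

end
end

section
/- ℓ²-norm bound for probability vectors with bounded ratios. Let b ≥ 1 and n ≥ 2 with n ≥ b − 1. If π ∈ ℝⁿ is a probability vector (π_i ≥ 0, Σ_i π_i = 1) whose entries satisfy π_i ≤ b π_j for all i, j, then ‖π‖₂ ≤ √(b/n). -/
/-- **ℓ²-norm bound for probability vectors with bounded ratios.**
If `π` is a probability vector on `n ≥ 2` items (with `n ≥ b - 1`) whose entries satisfy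
`π i ≤ b * π j` for all `i, j`, then `‖π‖₂ ≤ √(b/n)`. -/
theorem l2_norm_bound_prob_vector (b : ℝ) (n : ℕ) (hb : 1 ≤ b) (hn : 2 ≤ n)
    (hnb : b - 1 ≤ (n : ℝ)) (π : Fin n → ℝ)
    (hnonneg : ∀ i, 0 ≤ π i) (hsum : ∑ i, π i = 1)
    (hratio : ∀ i j, π i ≤ b * π j) :
    Real.sqrt (∑ i, π i ^ 2) ≤ Real.sqrt (b / n) := by
  have hn0 : (0 : ℝ) < n := by exact_mod_cast (by omega : 0 < n)
  have hle (i : Fin n) : π i ≤ b / n := by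
    have h : ∑ _j : Fin n, π i ≤ ∑ j, b * π j := Finset.sum_le_sum fun j _ => hratio i j
    rw [← Finset.mul_sum, hsum, mul_one, Finset.sum_const, Finset.card_univ, Fintype.card_fin,
      nsmul_eq_mul] at h
    rwa [le_div_iff₀' hn0]
  apply Real.sqrt_le_sqrt
  calc ∑ i, π i ^ 2 ≤ ∑ i, b / n * π i := Finset.sum_le_sum fun i _ => by
        rw [sq]
        exact mul_le_mul_of_nonneg_right (hle i) (hnonneg i)
    _ = b / n := by rw [← Finset.mul_sum, hsum, mul_one]
end
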